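/- There exists an absolute constant c > 0 with the following property. Let U be an n×d real matrix with UᵀU = I_d, with rows u_1ᵀ, …, u_nᵀ, and suppose max_{1 ≤ i ≤ n} ‖u_i‖₂² ≤ m. Let S = √(n/k) Φ be a uniform sketch of size k, where the k rows of Φ are independent and row r equals the standard basis row vector e_{I_r}ᵀ with I_r uniformly distributed on {1, …, n}. Then for every t ≥ 0, with probability at least 1 − 2d·exp(−c t²), one has 1 − t√(mn/k) ≤ σ_min(SU) ≤ σ_max(SU) ≤ 1 + t√(mn/k). -/

import Mathlib

open MeasureTheory ProbabilityTheory Matrix Filter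
open scoped ENNReal NNReal

/-- Matrices inherit the product measurable structure. -/
instance {m n α : Type*} [MeasurableSpace α] : MeasurableSpace (Matrix m n α) :=
  inferInstanceAs (MeasurableSpace (m → n → α))

/-- The largest eigenvalue of a square real matrix. -/
noncomputable def lambdaMax {d : ℕ} (M : Matrix (Fin d) (Fin d) ℝ) : ℝ :=
  sSup (spectrum ℝ M)

/-- The smallest eigenvalue of a square real matrix. -/
noncomputable def lambdaMin {d : ℕ} (M : Matrix (Fin d) (Fin d) ℝ) : ℝ :=
  sInf (spectrum ℝ M)

/-- The largest singular value of a rectangular real matrix. -/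
noncomputable def sigmaMax {a b : ℕ} (N : Matrix (Fin a) (Fin b) ℝ) : ℝ :=
  Real.sqrt (lambdaMax (Nᵀ * N))

/-- The smallest singular value of a rectangular real matrix. -/
noncomputable def sigmaMin {a b : ℕ} (N : Matrix (Fin a) (Fin b) ℝ) : ℝ :=
  Real.sqrt (lambdaMin (Nᵀ * N))

/-- The sampling randomness of the uniform sketch: `k` independent row indices,
each uniformly distributed on `Fin n`. -/
noncomputable def uniformRows (k n : ℕ) : Measure (Fin k → Fin n) :=
  Measure.pi fun _ : Fin k => ((n : ℝ≥0∞))⁻¹ • Measure.count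

/-- The uniform sketch `S = √(n/k) Φ` determined by the sampled row indices `ω`:
row `r` of `Φ` is the standard basis row vector `e_{ω r}ᵀ`. -/
noncomputable def uniformSketch (k n : ℕ) (ω : Fin k → Fin n) :
    Matrix (Fin k) (Fin n) ℝ :=
  Matrix.of fun r i => Real.sqrt ((n : ℝ) / (k : ℝ)) * (if ω r = i then 1 else 0)

/-- Young's inequality for complementary powers. -/
theorem mul_pow_mul_pow_le_weighted_add {x y : ℝ} (hx : 0 ≤ x) (hy : 0 ≤ y) {i q : ℕ}
    (hi : i ≤ q) (hq : 0 < q) :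
    q * (x ^ i * y ^ (q - i)) ≤ i * x ^ q + (q - i) * y ^ q := by
  have hq' : (0 : ℝ) < q := by exact_mod_cast hq
  have key := Real.geom_mean_le_arith_mean2_weighted (w₁ := i / q) (w₂ := ((q - i : ℕ) : ℝ) / q)
    (p₁ := x ^ q) (p₂ := y ^ q) (by positivity) (by positivity) (by positivity) (by positivity)
    (by rw [Nat.cast_sub hi]; field_simp; ring)
  have root : ∀ z : ℝ, 0 ≤ z → ∀ j : ℕ, (z ^ q) ^ ((j : ℝ) / q) = z ^ j := by
    intro z hz j
    rw [← Real.rpow_natCast z q, ← Real.rpow_mul hz, mul_div_cancel₀ _ hq'.ne', Real.rpow_natCast]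
  rw [root x hx, root y hy, Nat.cast_sub hi] at key
  calc q * (x ^ i * y ^ (q - i)) ≤ q * (i / q * x ^ q + (q - i) / q * y ^ q) := by gcongr
    _ = _ := by field_simp

theorem pow_sub_pow_eq_sum_mul_sub_mul {R : Type*} [Ring R] (x y : R) (q : ℕ) :
    x ^ q - y ^ q = ∑ i ∈ Finset.range q, x ^ i * (x - y) * y ^ (q - 1 - i) := by
  induction q with
  | zero => simp
  | succ q ih =>
    have h : ∑ i ∈ Finset.range q, x ^ i * (x - y) * y ^ (q + 1 - 1 - i) =
        (∑ i ∈ Finset.range q, x ^ i * (x - y) * y ^ (q - 1 - i)) * y := by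
      rw [Finset.sum_mul]
      refine Finset.sum_congr rfl fun i hi => ?_
      rw [Finset.mem_range] at hi
      rw [show q + 1 - 1 - i = (q - 1 - i) + 1 by omega, pow_succ]
      noncomm_ring
    rw [Finset.sum_range_succ, h, ← ih]
    simp only [add_tsub_cancel_right, tsub_self, pow_zero, pow_succ]
    noncomm_ring

theorem posSemidef_of_sub_smul_one {ι : Type*} [DecidableEq ι] {M : Matrix ι ι ℝ} {r : ℝ}
    (hr : 0 ≤ r)
    (hM : (M - r • (1 : Matrix ι ι ℝ)).PosSemidef) : M.PosSemidef := by
  simpa using hM.add (PosSemidef.one.smul hr)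

section QuadraticForm

variable {ι : Type*} [Fintype ι]

theorem dotProduct_mul_vecMulVec_mul_mulVec (A B : Matrix ι ι ℝ) (v : ι → ℝ) :
    v ⬝ᵥ ((A * vecMulVec v v * B) *ᵥ v) = (v ⬝ᵥ (A *ᵥ v)) * (v ⬝ᵥ (B *ᵥ v)) := by
  rw [← mulVec_mulVec, ← mulVec_mulVec, vecMulVec_mulVec]
  simp [mulVec_smul, dotProduct_smul, mul_comm]

theorem trace_mul_vecMulVec_self (A : Matrix ι ι ℝ) (v : ι → ℝ) :
    (A * vecMulVec v v).trace = v ⬝ᵥ (A *ᵥ v) := by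
  rw [mul_vecMulVec, trace_vecMulVec, dotProduct_comm]

theorem posSemidef_vecMulVec_self (v : ι → ℝ) : (vecMulVec v v).PosSemidef := by
  simpa using posSemidef_vecMulVec_self_star v

theorem exists_unit_smul_vecMulVec_eq {u : ι → ℝ} (hu : u ≠ 0) :
    ∃ v : ι → ℝ, v ⬝ᵥ v = 1 ∧ ∃ a : ℝ, a ^ 2 = u ⬝ᵥ u ∧ u = a • v := by
  have hpos : 0 < u ⬝ᵥ u := by
    simpa using (dotProduct_star_self_pos_iff (v := u)).mpr hu
  have hne : √(u ⬝ᵥ u) ≠ 0 := (Real.sqrt_pos.mpr hpos).ne'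
  refine ⟨(√(u ⬝ᵥ u))⁻¹ • u, ?_, √(u ⬝ᵥ u), Real.sq_sqrt hpos.le, ?_⟩
  · rw [dotProduct_smul, smul_dotProduct, smul_eq_mul, smul_eq_mul, ← mul_assoc, ← mul_inv,
      Real.mul_self_sqrt hpos.le, inv_mul_cancel₀ hpos.ne']
  · rw [smul_smul, mul_inv_cancel₀ hne, one_smul]

variable [DecidableEq ι]

/-- Simultaneous spectral representation of the powers of a real symmetric matrix. -/
theorem exists_spectral_pow {M : Matrix ι ι ℝ} (hM : M.PosSemidef) :
    ∃ (l : ι → ℝ) (Q : Matrix ι ι ℝ), (∀ a, 0 ≤ l a) ∧ Qᵀ * Q = 1 ∧ Q * Qᵀ = 1 ∧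
      ∀ i : ℕ, M ^ i = Q * diagonal (fun a => l a ^ i) * Qᵀ := by
  have hU := hM.1.eigenvectorUnitary.2
  rw [mem_unitaryGroup_iff, star_eq_conjTranspose, conjTranspose_eq_transpose_of_trivial] at hU
  set Q : Matrix ι ι ℝ := (hM.1.eigenvectorUnitary : Matrix ι ι ℝ)
  have hU' : Qᵀ * Q = 1 := mul_eq_one_comm.mp hU
  refine ⟨hM.1.eigenvalues, Q, hM.eigenvalues_nonneg, hU', hU, ?_⟩
  have h1 : M = Q * diagonal hM.1.eigenvalues * Qᵀ := by
    have := hM.1.spectral_theorem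
    rw [Unitary.conjStarAlgAut_apply] at this
    simpa [star_eq_conjTranspose, conjTranspose_eq_transpose_of_trivial, Function.comp_def]
      using this
  intro i
  induction i with
  | zero => simp [hU]
  | succ i ih =>
    rw [pow_succ, ih]
    calc Q * diagonal (fun a => hM.1.eigenvalues a ^ i) * Qᵀ * M
        = Q * diagonal (fun a => hM.1.eigenvalues a ^ i) * Qᵀ *
          (Q * diagonal hM.1.eigenvalues * Qᵀ) := congrArg _ h1
      _ = Q * diagonal (fun a => hM.1.eigenvalues a ^ i) * (Qᵀ * Q) *
          diagonal hM.1.eigenvalues * Qᵀ := by noncomm_ring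
      _ = _ := by
        rw [hU', mul_one, mul_assoc Q, diagonal_mul_diagonal]
        simp only [pow_succ]

theorem dotProduct_conj_diagonal_mulVec (Q : Matrix ι ι ℝ) (l v : ι → ℝ) :
    v ⬝ᵥ ((Q * diagonal l * Qᵀ) *ᵥ v) = ∑ a, (Qᵀ *ᵥ v) a ^ 2 * l a := by
  rw [← mulVec_mulVec, ← mulVec_mulVec, dotProduct_mulVec, ← mulVec_transpose, dotProduct]
  refine Finset.sum_congr rfl fun a _ => ?_
  rw [mulVec_diagonal]
  ring

theorem sum_sq_transpose_mulVec {Q : Matrix ι ι ℝ} (hQ : Q * Qᵀ = 1) (v : ι → ℝ) :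
    ∑ a, (Qᵀ *ᵥ v) a ^ 2 = v ⬝ᵥ v := by
  have := dotProduct_conj_diagonal_mulVec Q (fun _ => 1) v
  simpa [hQ, diagonal_one] using this.symm

/-- Lyapunov's inequality for the moments of a spectral measure. -/
theorem dotProduct_pow_mulVec_le_pow {M : Matrix ι ι ℝ} (hM : M.PosSemidef) {v : ι → ℝ}
    (hv : v ⬝ᵥ v = 1) {i q : ℕ} (hi : i ≤ q) (hq : 0 < q) {b : ℝ} (hb : 0 ≤ b)
    (h : v ⬝ᵥ (M ^ q *ᵥ v) = b ^ q) : v ⬝ᵥ (M ^ i *ᵥ v) ≤ b ^ i := by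
  obtain ⟨l, Q, hl, -, hQ, hpow⟩ := exists_spectral_pow hM
  have hw := sum_sq_transpose_mulVec hQ v
  rw [hv] at hw
  rw [hpow, dotProduct_conj_diagonal_mulVec] at h ⊢
  have hq' : (0 : ℝ) < q := by exact_mod_cast hq
  have young : q * ((∑ a, (Qᵀ *ᵥ v) a ^ 2 * l a ^ i) * b ^ (q - i)) ≤ q * b ^ q := by
    calc q * ((∑ a, (Qᵀ *ᵥ v) a ^ 2 * l a ^ i) * b ^ (q - i))
        = ∑ a, (Qᵀ *ᵥ v) a ^ 2 * (q * (l a ^ i * b ^ (q - i))) := by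
          rw [Finset.sum_mul, Finset.mul_sum]
          exact Finset.sum_congr rfl fun a _ => by ring
      _ ≤ ∑ a, (Qᵀ *ᵥ v) a ^ 2 * (i * l a ^ q + (q - i) * b ^ q) := by
          gcongr with a
          exact mul_pow_mul_pow_le_weighted_add (hl a) hb hi hq
      _ = i * ∑ a, (Qᵀ *ᵥ v) a ^ 2 * l a ^ q + (q - i) * b ^ q * ∑ a, (Qᵀ *ᵥ v) a ^ 2 := by
          rw [Finset.mul_sum, Finset.mul_sum, ← Finset.sum_add_distrib]
          exact Finset.sum_congr rfl fun a _ => by ring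
      _ = q * b ^ q := by rw [h, hw]; ring
  rcases hb.eq_or_lt with rfl | hb
  · rw [zero_pow hq.ne'] at h
    rcases Nat.eq_zero_or_pos i with rfl | hi0
    · simp [hw]
    · rw [zero_pow hi0.ne']
      rw [Finset.sum_eq_zero_iff_of_nonneg
        (fun a _ => mul_nonneg (sq_nonneg _) (pow_nonneg (hl a) _))] at h
      refine (Finset.sum_eq_zero fun a ha => ?_).le
      rcases mul_eq_zero.mp (h a ha) with h0 | h0
      · rw [h0, zero_mul]
      · rw [eq_zero_of_pow_eq_zero h0, zero_pow hi0.ne', mul_zero]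
  · have h2 : (∑ a, (Qᵀ *ᵥ v) a ^ 2 * l a ^ i) * b ^ (q - i) ≤ b ^ i * b ^ (q - i) := by
      rw [← pow_add, Nat.add_sub_cancel' hi]
      exact le_of_mul_le_mul_left young hq'
    exact le_of_mul_le_mul_right h2 (by positivity)

theorem dotProduct_pow_mulVec_nonneg {M : Matrix ι ι ℝ} (hM : M.PosSemidef) (q : ℕ)
    (v : ι → ℝ) : 0 ≤ v ⬝ᵥ (M ^ q *ᵥ v) := by
  simpa using (hM.pow q).dotProduct_mulVec_nonneg v

theorem exists_pow_eq_of_nonneg {x : ℝ} (hx : 0 ≤ x) {q : ℕ} (hq : 0 < q) :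
    ∃ b : ℝ, 0 ≤ b ∧ b ^ q = x :=
  ⟨x ^ ((q : ℝ)⁻¹), by positivity, Real.rpow_inv_natCast_pow hx hq.ne'⟩

/-- Minkowski's inequality for a rank one perturbation in the direction of the test vector. -/
theorem root_moment_add_rankOne_le {M : Matrix ι ι ℝ} (hM : M.PosSemidef) {v : ι → ℝ}
    (hv : v ⬝ᵥ v = 1) {s : ℝ} (hs : 0 ≤ s) {q : ℕ} (hq : 0 < q) {b g : ℝ} (hb : 0 ≤ b)
    (hg : 0 ≤ g) (hMb : v ⬝ᵥ (M ^ q *ᵥ v) = b ^ q)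
    (hMg : v ⬝ᵥ ((M + s • vecMulVec v v) ^ q *ᵥ v) = g ^ q) : g ≤ b + s := by
  by_contra! hlt
  have hX : (M + s • vecMulVec v v).PosSemidef :=
    hM.add ((posSemidef_vecMulVec_self v).smul hs)
  set X := M + s • vecMulVec v v with hXdef
  have h1 : g ^ q - b ^ q = s * ∑ i ∈ Finset.range q,
      (v ⬝ᵥ (X ^ i *ᵥ v)) * (v ⬝ᵥ (M ^ (q - 1 - i) *ᵥ v)) := by
    rw [← hMb, ← hMg, ← dotProduct_sub, ← sub_mulVec, pow_sub_pow_eq_sum_mul_sub_mul,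
      Matrix.sum_mulVec, dotProduct_sum, Finset.mul_sum]
    refine Finset.sum_congr rfl fun i _ => ?_
    rw [← dotProduct_mul_vecMulVec_mul_mulVec, hXdef, add_sub_cancel_left, ← hXdef]
    simp [smul_mulVec]
  have h2 : s * ∑ i ∈ Finset.range q,
      (v ⬝ᵥ (X ^ i *ᵥ v)) * (v ⬝ᵥ (M ^ (q - 1 - i) *ᵥ v)) ≤
      s * ∑ i ∈ Finset.range q, g ^ i * b ^ (q - 1 - i) := by
    gcongr with i hi
    · exact dotProduct_pow_mulVec_nonneg hM _ _
    · exact dotProduct_pow_mulVec_le_pow hX hv (Finset.mem_range.mp hi).le hq hg hMg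
    · exact dotProduct_pow_mulVec_le_pow hM hv (by omega) hq hb hMb
  have h3 := geom_sum₂_mul g b q
  have hpos : 0 < ∑ i ∈ Finset.range q, g ^ i * b ^ (q - 1 - i) := by
    refine Finset.sum_pos' (fun i _ => by positivity) ⟨q - 1, by simp [hq], ?_⟩
    have : 0 < g := by linarith
    simp only [tsub_self, pow_zero, mul_one]
    positivity
  nlinarith

theorem trace_mul_conj_diagonal (Q Y : Matrix ι ι ℝ) (l : ι → ℝ) :
    (Q * diagonal l * Qᵀ * Y).trace = ∑ a, l a * (Q.col a ⬝ᵥ (Y *ᵥ Q.col a)) := by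
  rw [mul_assoc Q, mul_assoc Q, trace_mul_comm, mul_assoc, mul_assoc, trace]
  refine Finset.sum_congr rfl fun a _ => ?_
  rw [diag_apply, diagonal_mul]
  simp [mul_apply, dotProduct, mulVec, col_apply, Finset.mul_sum]

theorem dotProduct_col_self {Q : Matrix ι ι ℝ} (hQ : Qᵀ * Q = 1) (a : ι) :
    Q.col a ⬝ᵥ Q.col a = 1 := by
  have := congrFun (congrFun hQ a) a
  simpa [mul_apply, dotProduct, col_apply] using this

/-- Klein's inequality for powers: the tangent bound of the convex function
`X ↦ trace (X ^ N)`. -/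
theorem trace_pow_le_add_of_tangent {X Y : Matrix ι ι ℝ} (hX : X.PosSemidef)
    (hY : Y.PosSemidef) (q : ℕ) :
    (X ^ (q + 1)).trace ≤ (Y ^ (q + 1)).trace + (q + 1) * (X ^ q * (X - Y)).trace := by
  obtain ⟨l, Q, hl, hQ', hQ, hpow⟩ := exists_spectral_pow hX
  have hcol := dotProduct_col_self hQ'
  have tr : ∀ i (Z : Matrix ι ι ℝ), (X ^ i * Z).trace =
      ∑ a, l a ^ i * (Q.col a ⬝ᵥ (Z *ᵥ Q.col a)) := by
    intro i Z
    rw [hpow, trace_mul_conj_diagonal]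
  have tr1 := tr (q + 1) 1
  have tr2 := tr 0 (Y ^ (q + 1))
  simp only [mul_one, one_mulVec, hcol, pow_zero, one_mul] at tr1 tr2
  have tr3 := tr q Y
  rw [mul_sub, trace_sub, ← pow_succ, tr1, tr2, tr3]
  have key : ∀ a, (q + 1) * (l a ^ q * (Q.col a ⬝ᵥ (Y *ᵥ Q.col a))) ≤
      q * l a ^ (q + 1) + Q.col a ⬝ᵥ (Y ^ (q + 1) *ᵥ Q.col a) := by
    intro a
    obtain ⟨b, hb, hbq⟩ := exists_pow_eq_of_nonneg
      (dotProduct_pow_mulVec_nonneg hY (q + 1) (Q.col a)) q.succ_pos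
    have h1 := dotProduct_pow_mulVec_le_pow hY (hcol a) (i := 1) (by omega) q.succ_pos hb hbq.symm
    have h2 := mul_pow_mul_pow_le_weighted_add (hl a) hb q.le_succ q.succ_pos
    rw [Nat.succ_eq_add_one] at hbq
    rw [pow_one, pow_one] at h1
    simp only [Nat.succ_eq_add_one, add_tsub_cancel_left, pow_one, Nat.cast_add,
      Nat.cast_one] at h2
    rw [← hbq]
    have h3 : (q + 1) * (l a ^ q * (Q.col a ⬝ᵥ (Y *ᵥ Q.col a))) ≤ (q + 1) * (l a ^ q * b) := by
      have := hl a
      gcongr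
    linarith
  have hsum := Finset.sum_le_sum fun a (_ : a ∈ Finset.univ) => key a
  rw [← Finset.mul_sum, Finset.sum_add_distrib, ← Finset.mul_sum] at hsum
  linarith

theorem dotProduct_mulVec_le_trace_mul {K : Matrix ι ι ℝ} (hK : K.PosSemidef) (v : ι → ℝ) :
    v ⬝ᵥ (K *ᵥ v) ≤ K.trace * (v ⬝ᵥ v) := by
  obtain ⟨l, Q, hl, hQ', hQ, hpow⟩ := exists_spectral_pow hK
  have h1 := hpow 1
  simp only [pow_one] at h1
  have htr : K.trace = ∑ a, l a := by
    have := trace_mul_conj_diagonal Q 1 l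
    rw [mul_one, ← h1] at this
    simpa [dotProduct_col_self hQ'] using this
  rw [htr, ← sum_sq_transpose_mulVec hQ v, h1, dotProduct_conj_diagonal_mulVec, Finset.mul_sum]
  refine Finset.sum_le_sum fun a _ => ?_
  rw [mul_comm]
  gcongr
  exact Finset.single_le_sum (fun b _ => hl b) (Finset.mem_univ a)

theorem eigenvalue_pow_le_trace_pow {M : Matrix ι ι ℝ} (hM : M.PosSemidef) {v : ι → ℝ}
    (hv : v ≠ 0) {r : ℝ} (h : M *ᵥ v = r • v) (N : ℕ) : r ^ N ≤ (M ^ N).trace := by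
  have hpow : M ^ N *ᵥ v = r ^ N • v := by
    induction N with
    | zero => simp
    | succ N ih => rw [pow_succ, ← mulVec_mulVec, h, mulVec_smul, ih, smul_smul, pow_succ, mul_comm]
  have hpos : 0 < v ⬝ᵥ v := by
    simpa using (dotProduct_star_self_pos_iff (v := v)).mpr hv
  have := dotProduct_mulVec_le_trace_mul (hM.pow N) v
  rw [hpow, dotProduct_smul, smul_eq_mul] at this
  exact le_of_mul_le_mul_right this hpos

theorem le_dotProduct_mulVec_of_posSemidef_sub {M : Matrix ι ι ℝ} {r : ℝ}
    (hM : (M - r • (1 : Matrix ι ι ℝ)).PosSemidef) (v : ι → ℝ) :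
    r * (v ⬝ᵥ v) ≤ v ⬝ᵥ (M *ᵥ v) := by
  have := hM.dotProduct_mulVec_nonneg v
  simp only [star_trivial, sub_mulVec, smul_mulVec, one_mulVec, dotProduct_sub, dotProduct_smul,
    smul_eq_mul] at this
  linarith

theorem dotProduct_pow_succ_mulVec_le {M : Matrix ι ι ℝ} (hM : M.PosSemidef)
    (hM1 : (1 - M).PosSemidef) (q : ℕ) (v : ι → ℝ) :
    v ⬝ᵥ (M ^ (q + 1) *ᵥ v) ≤ v ⬝ᵥ (M ^ q *ᵥ v) := by
  obtain ⟨l, Q, hl, hQ', hQ, hpow⟩ := exists_spectral_pow hM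
  have hle : ∀ a, l a ≤ 1 := by
    intro a
    have h1 := hM1.dotProduct_mulVec_nonneg (Q.col a)
    have h2 : Q.col a ⬝ᵥ (M *ᵥ Q.col a) = l a := by
      have h3 := hpow 1
      simp only [pow_one] at h3
      have h4 : Qᵀ *ᵥ Q.col a = Pi.single a 1 := by
        rw [← mulVec_single_one, mulVec_mulVec, hQ', one_mulVec]
      rw [h3, dotProduct_conj_diagonal_mulVec, h4, Finset.sum_eq_single a] <;>
        simp +contextual
    simp only [star_trivial, sub_mulVec, one_mulVec, dotProduct_sub, dotProduct_col_self hQ',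
      h2] at h1
    linarith
  rw [hpow, hpow, dotProduct_conj_diagonal_mulVec, dotProduct_conj_diagonal_mulVec]
  exact Finset.sum_le_sum fun a _ =>
    mul_le_mul_of_nonneg_left (pow_le_pow_of_le_one (hl a) (hle a) q.le_succ) (sq_nonneg _)

theorem posSemidef_smul_one_sub_vecMulVec {v : ι → ℝ} {c : ℝ} (hc : v ⬝ᵥ v ≤ c) :
    (c • (1 : Matrix ι ι ℝ) - vecMulVec v v).PosSemidef := by
  refine .of_dotProduct_mulVec_nonneg ?_ fun x => ?_
  · exact (PosSemidef.one.1.smul (by simp [IsSelfAdjoint])).sub (posSemidef_vecMulVec_self v).1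
  · have cs : (v ⬝ᵥ x) ^ 2 ≤ (v ⬝ᵥ v) * (x ⬝ᵥ x) := by
      have := Finset.sum_mul_sq_le_sq_mul_sq Finset.univ v x
      simpa [dotProduct, sq] using this
    have hx : 0 ≤ x ⬝ᵥ x := by simpa using dotProduct_star_self_nonneg x
    have h3 : (v ⬝ᵥ v) * (x ⬝ᵥ x) ≤ c * (x ⬝ᵥ x) := by gcongr
    simp only [star_trivial, sub_mulVec, smul_mulVec, one_mulVec, dotProduct_sub,
      dotProduct_smul, smul_eq_mul, vecMulVec_mulVec, op_smul_eq_smul]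
    rw [dotProduct_comm x v]
    nlinarith

theorem trace_pow_add_rankOne_le_of_unit {M : Matrix ι ι ℝ}
    (hM : (M - (1 : ℝ) • (1 : Matrix ι ι ℝ)).PosSemidef) {v : ι → ℝ} (hv : v ⬝ᵥ v = 1)
    {s : ℝ} (hs : 0 ≤ s) {q : ℕ} (hq : 0 < q) :
    ((M + s • vecMulVec v v) ^ (q + 1)).trace ≤
      (M ^ (q + 1)).trace + (q + 1) * s * (1 + s) ^ q * (v ⬝ᵥ (M ^ (q + 1) *ᵥ v)) := by
  have hMp := posSemidef_of_sub_smul_one zero_le_one hM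
  have hX := hMp.add ((posSemidef_vecMulVec_self v).smul hs)
  have hge := le_dotProduct_mulVec_of_posSemidef_sub hM v
  rw [hv, mul_one] at hge
  obtain ⟨b, hb, hbq⟩ := exists_pow_eq_of_nonneg (dotProduct_pow_mulVec_nonneg hMp q v) hq
  obtain ⟨g, hg, hgq⟩ := exists_pow_eq_of_nonneg (dotProduct_pow_mulVec_nonneg hX q v) hq
  obtain ⟨b', hb', hbq'⟩ :=
    exists_pow_eq_of_nonneg (dotProduct_pow_mulVec_nonneg hMp (q + 1) v) q.succ_pos
  have h1 := dotProduct_pow_mulVec_le_pow hMp hv (i := 1) hq hq hb hbq.symm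
  have h1' := dotProduct_pow_mulVec_le_pow hMp hv (i := 1) (by omega) q.succ_pos hb' hbq'.symm
  have h2 := dotProduct_pow_mulVec_le_pow hMp hv q.le_succ q.succ_pos hb' hbq'.symm
  have hgb := root_moment_add_rankOne_le hMp hv hs hq hb hg hbq.symm hgq.symm
  have klein := trace_pow_le_add_of_tangent hX hMp q
  rw [add_sub_cancel_left, mul_smul_comm, trace_smul, trace_mul_vecMulVec_self, ← hgq,
    smul_eq_mul] at klein
  simp only [pow_one] at h1 h1'
  have hbb : b ^ q ≤ v ⬝ᵥ (M ^ (q + 1) *ᵥ v) := by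
    rw [hbq, ← hbq']
    exact h2.trans (pow_le_pow_right₀ (hge.trans h1') q.le_succ)
  have hgb' : g ^ q ≤ (1 + s) ^ q * (v ⬝ᵥ (M ^ (q + 1) *ᵥ v)) := by
    calc g ^ q ≤ ((1 + s) * b) ^ q := by
          gcongr
          nlinarith
      _ = (1 + s) ^ q * b ^ q := mul_pow _ _ _
      _ ≤ _ := by gcongr
  refine klein.trans ?_
  rw [mul_assoc, mul_assoc]
  gcongr

theorem trace_pow_sub_rankOne_le_of_unit {M : Matrix ι ι ℝ} {r : ℝ} (hr : 0 < r)
    (hM : (M - r • (1 : Matrix ι ι ℝ)).PosSemidef) (hM1 : (1 - M).PosSemidef) {v : ι → ℝ}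
    (hv : v ⬝ᵥ v = 1) {s : ℝ} (hs : 0 ≤ s) (hsr : s ≤ r)
    (hX : (M - s • vecMulVec v v).PosSemidef) {q : ℕ} (hq : 0 < q) :
    ((M - s • vecMulVec v v) ^ (q + 1)).trace ≤
      (M ^ (q + 1)).trace - (q + 1) * s * (1 - s / r) ^ q * (v ⬝ᵥ (M ^ (q + 1) *ᵥ v)) := by
  have hMp := posSemidef_of_sub_smul_one hr.le hM
  have hge := le_dotProduct_mulVec_of_posSemidef_sub hM v
  rw [hv, mul_one] at hge
  obtain ⟨b, hb, hbq⟩ := exists_pow_eq_of_nonneg (dotProduct_pow_mulVec_nonneg hMp q v) hq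
  obtain ⟨g, hg, hgq⟩ := exists_pow_eq_of_nonneg (dotProduct_pow_mulVec_nonneg hX q v) hq
  have h1 := dotProduct_pow_mulVec_le_pow hMp hv (i := 1) hq hq hb hbq.symm
  simp only [pow_one] at h1
  have hgb := root_moment_add_rankOne_le hX hv hs hq hg hb hgq.symm
    (by rw [sub_add_cancel]; exact hbq.symm)
  have klein := trace_pow_le_add_of_tangent hX hMp q
  rw [sub_sub_cancel_left, mul_neg, mul_smul_comm, trace_neg, trace_smul,
    trace_mul_vecMulVec_self, ← hgq, smul_eq_mul] at klein
  have hbb := dotProduct_pow_succ_mulVec_le hMp hM1 q v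
  rw [← hbq] at hbb
  have hsr' : 0 ≤ 1 - s / r := sub_nonneg.mpr ((div_le_one hr).mpr hsr)
  have hgb' : (1 - s / r) ^ q * (v ⬝ᵥ (M ^ (q + 1) *ᵥ v)) ≤ g ^ q := by
    calc _ ≤ (1 - s / r) ^ q * b ^ q := by gcongr
      _ = ((1 - s / r) * b) ^ q := (mul_pow _ _ _).symm
      _ ≤ g ^ q := by
        gcongr
        have : s ≤ s / r * b := by
          rw [div_mul_eq_mul_div, le_div_iff₀ hr]
          nlinarith
        linarith
  have := mul_le_mul_of_nonneg_left hgb' (show 0 ≤ (q + 1 : ℝ) * s by positivity)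
  linarith

theorem trace_pow_add_rankOne_le {M : Matrix ι ι ℝ}
    (hM : (M - (1 : ℝ) • (1 : Matrix ι ι ℝ)).PosSemidef) (u : ι → ℝ) {s a : ℝ} (hs : 0 ≤ s)
    {q : ℕ} (hq : 0 < q) (ha : (q + 1) * (s * (u ⬝ᵥ u)) ≤ a) :
    ((M + s • vecMulVec u u) ^ (q + 1)).trace ≤
      (M ^ (q + 1)).trace + (q + 1) * s * Real.exp a * (u ⬝ᵥ (M ^ (q + 1) *ᵥ u)) := by
  rcases eq_or_ne u 0 with rfl | hu
  · simp
  obtain ⟨v, hv, c, hc, rfl⟩ := exists_unit_smul_vecMulVec_eq hu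
  rw [← hc] at ha
  have h := trace_pow_add_rankOne_le_of_unit hM hv (s := s * c ^ 2) (by positivity) hq
  have hMp := posSemidef_of_sub_smul_one zero_le_one hM
  have hexp : (1 + s * c ^ 2) ^ q ≤ Real.exp a := by
    calc (1 + s * c ^ 2) ^ q ≤ Real.exp (s * c ^ 2) ^ q := by
          gcongr
          linarith [Real.add_one_le_exp (s * c ^ 2)]
      _ = Real.exp (q * (s * c ^ 2)) := (Real.exp_nat_mul _ _).symm
      _ ≤ Real.exp a := by
        gcongr
        have : 0 ≤ s * c ^ 2 := by positivity
        linarith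
  have hm : s • vecMulVec (c • v) (c • v) = (s * c ^ 2) • vecMulVec v v := by
    rw [smul_vecMulVec, vecMulVec_smul, smul_smul, smul_smul]
    ring_nf
  rw [hm, mulVec_smul, dotProduct_smul, smul_dotProduct, smul_eq_mul, smul_eq_mul]
  refine h.trans ?_
  have hn := dotProduct_pow_mulVec_nonneg hMp (q + 1) v
  calc _ ≤ (M ^ (q + 1)).trace +
        (q + 1) * (s * c ^ 2) * Real.exp a * (v ⬝ᵥ (M ^ (q + 1) *ᵥ v)) := by gcongr
    _ = _ := by ring

theorem trace_pow_sub_rankOne_le {M : Matrix ι ι ℝ}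
    (hM : (M - (1 / 2 : ℝ) • (1 : Matrix ι ι ℝ)).PosSemidef) (hM1 : (1 - M).PosSemidef)
    (u : ι → ℝ) {s a : ℝ} (hs : 0 ≤ s) (hX : (M - s • vecMulVec u u).PosSemidef) {q : ℕ}
    (hq : 0 < q) (ha : (q + 1) * (s * (u ⬝ᵥ u)) ≤ a) (ha1 : a ≤ 1 / 2) :
    ((M - s • vecMulVec u u) ^ (q + 1)).trace ≤
      (M ^ (q + 1)).trace - (q + 1) * s * (1 - 2 * a) * (u ⬝ᵥ (M ^ (q + 1) *ᵥ u)) := by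
  rcases eq_or_ne u 0 with rfl | hu
  · simp
  obtain ⟨v, hv, c, hc, rfl⟩ := exists_unit_smul_vecMulVec_eq hu
  rw [← hc] at ha
  have hm : s • vecMulVec (c • v) (c • v) = (s * c ^ 2) • vecMulVec v v := by
    rw [smul_vecMulVec, vecMulVec_smul, smul_smul, smul_smul]
    ring_nf
  have hsc : 0 ≤ s * c ^ 2 := by positivity
  have hq0 : (0 : ℝ) ≤ q := by positivity
  have hsc1 : s * c ^ 2 ≤ 1 / 2 := by nlinarith
  rw [hm] at hX
  have h := trace_pow_sub_rankOne_le_of_unit (by norm_num) hM hM1 hv hsc hsc1 hX hq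
  have hMp := posSemidef_of_sub_smul_one (by norm_num) hM
  have hbern : 1 - 2 * a ≤ (1 - s * c ^ 2 / (1 / 2)) ^ q := by
    have := one_add_mul_le_pow (a := -(s * c ^ 2 / (1 / 2))) (by linarith) q
    rw [← sub_eq_add_neg] at this
    refine le_trans ?_ this
    linarith
  rw [hm, mulVec_smul, dotProduct_smul, smul_dotProduct, smul_eq_mul, smul_eq_mul]
  refine h.trans ?_
  have hn := dotProduct_pow_mulVec_nonneg hMp (q + 1) v
  calc _ ≤ (M ^ (q + 1)).trace -
        (q + 1) * (s * c ^ 2) * (1 - 2 * a) * (v ⬝ᵥ (M ^ (q + 1) *ᵥ v)) := by gcongr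
    _ = _ := by ring

end QuadraticForm

/-- Iterating a one-step bound on the average growth of a potential along a random walk. -/
theorem sum_walk_le {α κ : Type*} [AddCommMonoid α] [Fintype κ] {f : α → ℝ} {z : κ → α}
    {p : ℕ → α → Prop} {C : ℝ} (hC : 0 ≤ C) (hp : ∀ j a i, p (j + 1) a → p j (a + z i))
    (hf : ∀ j a, p (j + 1) a → ∑ i, f (a + z i) ≤ C * f a) (k : ℕ) {a : α} (ha : p k a) :
    ∑ ω : Fin k → κ, f (a + ∑ r, z (ω r)) ≤ C ^ k * f a := by
  induction k generalizing a with
  | zero => simp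
  | succ k ih =>
    rw [← (Fin.consEquiv fun _ => κ).sum_comp, Fintype.sum_prod_type]
    calc ∑ i, ∑ ω : Fin k → κ, f (a + ∑ r, z ((Fin.consEquiv fun _ => κ) (i, ω) r))
        = ∑ i, ∑ ω : Fin k → κ, f (a + z i + ∑ r, z (ω r)) := by
          simp [Fin.consEquiv, Fin.sum_univ_succ, add_assoc]
      _ ≤ ∑ i, C ^ k * f (a + z i) := Finset.sum_le_sum fun i _ => ih (hp _ _ _ ha)
      _ = C ^ k * ∑ i, f (a + z i) := (Finset.mul_sum _ _ _).symm
      _ ≤ C ^ k * (C * f a) := by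
          gcongr
          exact hf _ _ ha
      _ = C ^ (k + 1) * f a := by ring

theorem walk_invariant {α κ : Type*} [AddCommMonoid α] {z : κ → α} {p : ℕ → α → Prop}
    (hp : ∀ j a i, p (j + 1) a → p j (a + z i)) (k : ℕ) {a : α} (ha : p k a) (ω : Fin k → κ) :
    p 0 (a + ∑ r, z (ω r)) := by
  induction k generalizing a with
  | zero => simpa using ha
  | succ k ih =>
    rw [Fin.sum_univ_succ, ← add_assoc]
    exact ih (hp _ _ _ ha) fun r => ω r.succ

section Sampling

variable {ι κ : Type*} [DecidableEq ι]

theorem walk_step_lower [Fintype ι] {u : κ → ι → ℝ} {s e : ℝ} (hs : 0 ≤ s)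
    (he : ∀ i, s * (u i ⬝ᵥ u i) ≤ e) (j : ℕ) (M : Matrix ι ι ℝ) (i : κ)
    (hM : (M - (1 / 2 + (j + 1 : ℕ) * e) • (1 : Matrix ι ι ℝ)).PosSemidef ∧ (1 - M).PosSemidef) :
    (M + -s • vecMulVec (u i) (u i) - (1 / 2 + j * e) • (1 : Matrix ι ι ℝ)).PosSemidef ∧
      (1 - (M + -s • vecMulVec (u i) (u i))).PosSemidef := by
  constructor
  · have h : (e • (1 : Matrix ι ι ℝ) - s • vecMulVec (u i) (u i)).PosSemidef := by
      have := posSemidef_smul_one_sub_vecMulVec (v := √s • u i) (c := e) (by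
        rw [dotProduct_smul, smul_dotProduct, smul_eq_mul, smul_eq_mul, ← mul_assoc,
          Real.mul_self_sqrt hs]
        exact he i)
      rwa [smul_vecMulVec, vecMulVec_smul, smul_smul, Real.mul_self_sqrt hs] at this
    convert hM.1.add h using 1
    push_cast
    module
  · convert hM.2.add ((posSemidef_vecMulVec_self (u i)).smul hs) using 1
    module

variable [Fintype κ]

/-- The rescaled Gram matrix of the sampled rows. -/
noncomputable def sampledGram (u : κ → ι → ℝ) {k : ℕ} (ω : Fin k → κ) : Matrix ι ι ℝ :=
  ((Fintype.card κ : ℝ) / k) • ∑ r, vecMulVec (u (ω r)) (u (ω r))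

theorem one_add_sum_smul_vecMulVec (u : κ → ι → ℝ) {k : ℕ} (ω : Fin k → κ) (c : ℝ) :
    1 + ∑ r, (c * (Fintype.card κ / k)) • vecMulVec (u (ω r)) (u (ω r)) =
      1 + c • sampledGram u ω := by
  rw [sampledGram, smul_smul, Finset.smul_sum]

variable [Fintype ι]

theorem sum_dotProduct_mulVec_eq_trace {u : κ → ι → ℝ}
    (hu : ∑ i, vecMulVec (u i) (u i) = (1 : Matrix ι ι ℝ)) (K : Matrix ι ι ℝ) :
    ∑ i, u i ⬝ᵥ (K *ᵥ u i) = K.trace := by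
  simp_rw [← trace_mul_vecMulVec_self]
  rw [← trace_sum, ← Finset.mul_sum, hu, mul_one]

/-- Markov's inequality for the eigenvalues of a random matrix, in counting form. -/
theorem card_eigenvalue_mul_pow_le {Ω : Type*} [Fintype Ω] {A : Ω → Matrix ι ι ℝ} {c y : ℝ}
    {N : ℕ} (P : ℝ → Prop) [DecidablePred fun ω => ∃ μ ∈ spectrum ℝ (A ω), P μ]
    (hA : ∀ ω, (1 + c • A ω).PosSemidef) (hP : ∀ μ, P μ → c * y ≤ c * μ) (hy : 0 ≤ 1 + c * y) :
    (Finset.univ.filter fun ω => ∃ μ ∈ spectrum ℝ (A ω), P μ).card * (1 + c * y) ^ N ≤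
      ∑ ω, ((1 + c • A ω) ^ N).trace := by
  rw [← nsmul_eq_mul]
  refine (Finset.card_nsmul_le_sum _ (fun ω => ((1 + c • A ω) ^ N).trace) _ fun ω hω => ?_).trans
    (Finset.sum_le_sum_of_subset_of_nonneg (Finset.filter_subset _ _)
      fun ω _ _ => ((hA ω).pow N).trace_nonneg)
  obtain ⟨μ, hμ, hPμ⟩ := (Finset.mem_filter.mp hω).2
  rw [← spectrum_toLin', ← Module.End.hasEigenvalue_iff_mem_spectrum] at hμ
  obtain ⟨v, hv⟩ := hμ.exists_hasEigenvector
  have hAv : A ω *ᵥ v = μ • v := by simpa using hv.apply_eq_smul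
  refine le_trans ?_ (eigenvalue_pow_le_trace_pow (hA ω) hv.2 (r := 1 + c * μ) ?_ N)
  · have := hP μ hPμ
    gcongr
  · rw [add_mulVec, one_mulVec, smul_mulVec, hAv, add_smul, one_smul, smul_smul]

theorem sum_trace_pow_upper {u : κ → ι → ℝ}
    (hu : ∑ i, vecMulVec (u i) (u i) = (1 : Matrix ι ι ℝ)) {s a b : ℝ} {q : ℕ} (hs : 0 ≤ s)
    (hq : 0 < q) (ha : ∀ i, (q + 1) * (s * (u i ⬝ᵥ u i)) ≤ a)
    (hb : (q + 1) * s * Real.exp a = Fintype.card κ * b) (k : ℕ) :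
    ∑ ω : Fin k → κ, ((1 + ∑ r, s • vecMulVec (u (ω r)) (u (ω r))) ^ (q + 1)).trace ≤
      (Fintype.card κ * Real.exp b) ^ k * Fintype.card ι := by
  have := sum_walk_le (f := fun M : Matrix ι ι ℝ => (M ^ (q + 1)).trace)
    (z := fun i => s • vecMulVec (u i) (u i))
    (p := fun _ M => (M - (1 : ℝ) • (1 : Matrix ι ι ℝ)).PosSemidef)
    (C := Fintype.card κ * Real.exp b) (by positivity) ?_ ?_ k (a := 1) ?_
  · simpa using this
  · intro j M i hM
    rw [add_sub_right_comm]
    exact hM.add ((posSemidef_vecMulVec_self _).smul hs)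
  · intro j M hM
    have htr := ((posSemidef_of_sub_smul_one zero_le_one hM).pow (q + 1)).trace_nonneg
    calc ∑ i, ((M + s • vecMulVec (u i) (u i)) ^ (q + 1)).trace
        ≤ ∑ i, ((M ^ (q + 1)).trace +
            (q + 1) * s * Real.exp a * (u i ⬝ᵥ (M ^ (q + 1) *ᵥ u i))) :=
          Finset.sum_le_sum fun i _ => trace_pow_add_rankOne_le hM (u i) hs hq (ha i)
      _ = Fintype.card κ * ((b + 1) * (M ^ (q + 1)).trace) := by
          rw [Finset.sum_add_distrib, ← Finset.mul_sum, sum_dotProduct_mulVec_eq_trace hu, hb]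
          simp
          ring
      _ ≤ Fintype.card κ * (Real.exp b * (M ^ (q + 1)).trace) := by
          gcongr
          exact Real.add_one_le_exp b
      _ = _ := by ring
  · simpa using PosSemidef.zero

theorem sum_trace_pow_lower {u : κ → ι → ℝ}
    (hu : ∑ i, vecMulVec (u i) (u i) = (1 : Matrix ι ι ℝ)) {s e a b : ℝ} {q k : ℕ} (hs : 0 ≤ s)
    (he0 : 0 ≤ e) (he : ∀ i, s * (u i ⬝ᵥ u i) ≤ e) (hk : k * e ≤ 1 / 2) (hq : 0 < q)
    (ha : (q + 1) * e ≤ a) (ha1 : a ≤ 1 / 2)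
    (hb : (q + 1) * s * (1 - 2 * a) = Fintype.card κ * b) :
    (∀ ω : Fin k → κ, (1 + ∑ r, -s • vecMulVec (u (ω r)) (u (ω r))).PosSemidef) ∧
    ∑ ω : Fin k → κ, ((1 + ∑ r, -s • vecMulVec (u (ω r)) (u (ω r))) ^ (q + 1)).trace ≤
      (Fintype.card κ * Real.exp (-b)) ^ k * Fintype.card ι := by
  have hstart : ((1 : Matrix ι ι ℝ) - (1 / 2 + k * e) • (1 : Matrix ι ι ℝ)).PosSemidef ∧
      (1 - (1 : Matrix ι ι ℝ)).PosSemidef := by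
    constructor
    · have : (1 : Matrix ι ι ℝ) - (1 / 2 + k * e) • (1 : Matrix ι ι ℝ) =
          (1 - (1 / 2 + k * e)) • (1 : Matrix ι ι ℝ) := by module
      rw [this]
      exact PosSemidef.one.smul (by linarith)
    · simpa using PosSemidef.zero
  have step := walk_step_lower hs he
  constructor
  · intro ω
    have := walk_invariant (z := fun i => -s • vecMulVec (u i) (u i))
      (p := fun j M => (M - (1 / 2 + j * e) • (1 : Matrix ι ι ℝ)).PosSemidef ∧ (1 - M).PosSemidef)
      step k hstart ω
    exact posSemidef_of_sub_smul_one (by positivity) this.1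
  have := sum_walk_le (f := fun M : Matrix ι ι ℝ => (M ^ (q + 1)).trace)
    (z := fun i => -s • vecMulVec (u i) (u i))
    (p := fun j M => (M - (1 / 2 + j * e) • (1 : Matrix ι ι ℝ)).PosSemidef ∧ (1 - M).PosSemidef)
    (C := Fintype.card κ * Real.exp (-b)) (by positivity) step ?_ k (a := 1) hstart
  · simpa using this
  · intro j M hM
    have hM' : (M - (1 / 2 : ℝ) • (1 : Matrix ι ι ℝ)).PosSemidef := by
      convert hM.1.add (PosSemidef.one.smul (show 0 ≤ ((j + 1 : ℕ) : ℝ) * e by positivity)) using 1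
      module
    have htr := ((posSemidef_of_sub_smul_one (by norm_num) hM').pow (q + 1)).trace_nonneg
    have hX : ∀ i, (M - s • vecMulVec (u i) (u i)).PosSemidef := by
      intro i
      have := posSemidef_of_sub_smul_one (by positivity) (step j M i hM).1
      rwa [neg_smul, ← sub_eq_add_neg] at this
    simp only [neg_smul, ← sub_eq_add_neg]
    calc ∑ i, ((M - s • vecMulVec (u i) (u i)) ^ (q + 1)).trace
        ≤ ∑ i, ((M ^ (q + 1)).trace -
            (q + 1) * s * (1 - 2 * a) * (u i ⬝ᵥ (M ^ (q + 1) *ᵥ u i))) :=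
          Finset.sum_le_sum fun i _ => trace_pow_sub_rankOne_le hM' hM.2 (u i) hs (hX i) hq
            ((mul_le_mul_of_nonneg_left (he i) (by positivity)).trans ha) ha1
      _ = Fintype.card κ * ((-b + 1) * (M ^ (q + 1)).trace) := by
          rw [Finset.sum_sub_distrib, ← Finset.mul_sum, sum_dotProduct_mulVec_eq_trace hu, hb]
          simp
          ring
      _ ≤ Fintype.card κ * (Real.exp (-b) * (M ^ (q + 1)).trace) := by
          gcongr
          exact Real.add_one_le_exp (-b)
      _ = _ := by ring

open Classical in
theorem card_upper_tail_le {u : κ → ι → ℝ}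
    (hu : ∑ i, vecMulVec (u i) (u i) = (1 : Matrix ι ι ℝ)) {k : ℕ} (hk : 0 < k) {m θ a y : ℝ}
    (hm : ∀ i, u i ⬝ᵥ u i ≤ m) (hθ : 0 ≤ θ) (ha : θ * (m * Fintype.card κ / k) ≤ a)
    (hy : 0 ≤ y) :
    (Finset.univ.filter fun ω : Fin k → κ =>
        ∃ μ ∈ spectrum ℝ (sampledGram u ω), y ≤ μ).card * Real.exp (θ * y) ≤
      Fintype.card κ ^ k * (Fintype.card ι * Real.exp (θ * Real.exp a)) := by
  have hk' : (0 : ℝ) < k := by exact_mod_cast hk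
  refine le_of_tendsto
    ((Real.tendsto_one_add_div_pow_exp (θ * y)).const_mul _) ?_
  filter_upwards [eventually_ge_atTop 2] with N hN
  obtain ⟨q, rfl⟩ : ∃ q, N = q + 1 := ⟨N - 1, by omega⟩
  have hs : 0 ≤ θ / (q + 1 : ℕ) * (Fintype.card κ / k) := by positivity
  have h1 := sum_trace_pow_upper hu (a := a) (b := θ * Real.exp a / k) (q := q) hs (by omega)
    (fun i => ?_) (by push_cast; field_simp) k
  · simp_rw [one_add_sum_smul_vecMulVec] at h1
    have h2 := card_eigenvalue_mul_pow_le (A := sampledGram u (k := k)) (N := q + 1)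
      (c := θ / (q + 1 : ℕ)) (y := y) (fun μ => y ≤ μ) (fun ω => ?_) (fun μ h => by gcongr)
      (by positivity)
    · rw [div_mul_eq_mul_div] at h2
      refine h2.trans (h1.trans_eq ?_)
      rw [mul_pow, ← Real.exp_nat_mul, mul_div_cancel₀ _ hk'.ne']
      ring
    · rw [← one_add_sum_smul_vecMulVec]
      exact PosSemidef.one.add
        (posSemidef_sum _ fun r _ => (posSemidef_vecMulVec_self _).smul hs)
  · refine le_trans ?_ ha
    calc ((q : ℝ) + 1) * (θ / (q + 1 : ℕ) * (Fintype.card κ / k) * (u i ⬝ᵥ u i))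
        = θ * ((u i ⬝ᵥ u i) * Fintype.card κ / k) := by push_cast; field_simp
      _ ≤ _ := by
        gcongr
        exact hm i

open Classical in
theorem card_lower_tail_le {u : κ → ι → ℝ}
    (hu : ∑ i, vecMulVec (u i) (u i) = (1 : Matrix ι ι ℝ)) {k : ℕ} (hk : 0 < k) {m θ a y : ℝ}
    (hm0 : 0 ≤ m) (hm : ∀ i, u i ⬝ᵥ u i ≤ m) (hθ : 0 ≤ θ)
    (ha : θ * (m * Fintype.card κ / k) ≤ a) (ha1 : a ≤ 1 / 2) :
    (Finset.univ.filter fun ω : Fin k → κ =>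
        ∃ μ ∈ spectrum ℝ (sampledGram u ω), μ ≤ y).card * Real.exp (-(θ * y)) ≤
      Fintype.card κ ^ k * (Fintype.card ι * Real.exp (-(θ * (1 - 2 * a)))) := by
  have hk' : (0 : ℝ) < k := by exact_mod_cast hk
  refine le_of_tendsto
    ((Real.tendsto_one_add_div_pow_exp (-(θ * y))).const_mul _) ?_
  filter_upwards [eventually_ge_atTop 2, eventually_ge_atTop k,
    eventually_ge_atTop ⌈θ * y⌉₊] with N hN hNk hNy
  obtain ⟨q, rfl⟩ : ∃ q, N = q + 1 := ⟨N - 1, by omega⟩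
  have hy : θ * y / (q + 1 : ℕ) ≤ 1 := by
    rw [div_le_one (by positivity)]
    exact Nat.ceil_le.mp hNy
  have hs : 0 ≤ θ / (q + 1 : ℕ) * (Fintype.card κ / k) := by positivity
  have hNk' : (k : ℝ) ≤ (q + 1 : ℕ) := by exact_mod_cast hNk
  have he : ((q : ℝ) + 1) * (θ / (q + 1 : ℕ) * (Fintype.card κ / k) * m) ≤ a := by
    refine le_trans (le_of_eq ?_) ha
    push_cast
    field_simp
  have he0 : 0 ≤ θ / (q + 1 : ℕ) * (Fintype.card κ / k) * m := by positivity
  obtain ⟨hpsd, h1⟩ := sum_trace_pow_lower hu (a := a) (b := θ * (1 - 2 * a) / k) (q := q) (k := k)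
    hs he0 (fun i => mul_le_mul_of_nonneg_left (hm i) hs)
    (by push_cast at *; nlinarith) (by omega) he ha1 (by push_cast; field_simp)
  simp_rw [← neg_mul, one_add_sum_smul_vecMulVec] at h1 hpsd
  have h2 := card_eigenvalue_mul_pow_le (A := sampledGram u (k := k)) (N := q + 1)
    (c := -(θ / (q + 1 : ℕ))) (y := y) (fun μ => μ ≤ y) hpsd
    (fun μ h => mul_le_mul_of_nonpos_left h (neg_nonpos.mpr (by positivity)))
    (by rw [neg_mul, div_mul_eq_mul_div]; linarith)
  rw [neg_mul, div_mul_eq_mul_div, ← neg_div] at h2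
  refine h2.trans (h1.trans_eq ?_)
  rw [mul_pow, ← Real.exp_nat_mul, mul_neg, mul_div_cancel₀ _ hk'.ne']
  ring

end Sampling

theorem uniformSketch_mul_gram {n d k : ℕ} (U : Matrix (Fin n) (Fin d) ℝ) (ω : Fin k → Fin n) :
    (uniformSketch k n ω * U)ᵀ * (uniformSketch k n ω * U) = sampledGram U ω := by
  have h : ∀ r j, (uniformSketch k n ω * U) r j = √((n : ℝ) / k) * U (ω r) j := by
    intro r j
    simp [uniformSketch, mul_apply]
  ext i j
  unfold sampledGram
  rw [mul_apply, Matrix.smul_apply, Matrix.sum_apply, smul_eq_mul, Finset.mul_sum]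
  refine Finset.sum_congr rfl fun r _ => ?_
  rw [transpose_apply, h, h, vecMulVec_apply, Fintype.card_fin]
  have := Real.mul_self_sqrt (show 0 ≤ (n : ℝ) / k by positivity)
  linear_combination (U (ω r) i * U (ω r) j) * this

theorem spectrum_nonempty_of_isHermitian {d : ℕ} (hd : 0 < d) {A : Matrix (Fin d) (Fin d) ℝ}
    (hA : A.IsHermitian) : (spectrum ℝ A).Nonempty := by
  have : Nonempty (Fin d) := ⟨⟨0, hd⟩⟩
  rw [hA.spectrum_real_eq_range_eigenvalues]
  exact Set.range_nonempty _

theorem sigmaMax_le_of_spectrum_lt {a b : ℕ} (hb : 0 < b) {N : Matrix (Fin a) (Fin b) ℝ} {y : ℝ}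
    (hy : 0 ≤ y) (h : ∀ μ ∈ spectrum ℝ (Nᵀ * N), μ < y ^ 2) : sigmaMax N ≤ y :=
  Real.sqrt_le_iff.mpr ⟨hy, csSup_le (spectrum_nonempty_of_isHermitian hb
    (isHermitian_conjTranspose_mul_self N)) fun μ hμ => (h μ hμ).le⟩

theorem le_sigmaMin_of_lt_spectrum {a b : ℕ} (hb : 0 < b) {N : Matrix (Fin a) (Fin b) ℝ} {y : ℝ}
    (h : ∀ μ ∈ spectrum ℝ (Nᵀ * N), y ^ 2 < μ) : y ≤ sigmaMin N :=
  Real.le_sqrt_of_sq_le (le_csInf (spectrum_nonempty_of_isHermitian hb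
    (isHermitian_conjTranspose_mul_self N)) fun μ hμ => (h μ hμ).le)

theorem isProbabilityMeasure_inv_smul_count {n : ℕ} (hn : 0 < n) :
    IsProbabilityMeasure ((n : ℝ≥0∞)⁻¹ • (Measure.count : Measure (Fin n))) := by
  refine ⟨?_⟩
  rw [Measure.smul_apply, smul_eq_mul, Measure.count_univ]
  simp only [ENat.card_eq_coe_fintype_card, Fintype.card_fin, ENat.toENNReal_coe]
  exact ENNReal.inv_mul_cancel (by exact_mod_cast hn.ne') (ENNReal.natCast_ne_top n)

theorem one_sub_card_div_le_uniformRows {n k : ℕ} (hn : 0 < n) {s : Set (Fin k → Fin n)}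
    {B : Finset (Fin k → Fin n)} (h : ∀ ω ∉ B, ω ∈ s) :
    ENNReal.ofReal (1 - B.card / (n : ℝ) ^ k) ≤ uniformRows k n s := by
  have := isProbabilityMeasure_inv_smul_count hn
  have : IsProbabilityMeasure (uniformRows k n) := by
    unfold uniformRows
    infer_instance
  have hn' : (0 : ℝ) < n := by exact_mod_cast hn
  have hB : uniformRows k n B = ENNReal.ofReal (B.card / (n : ℝ) ^ k) := by
    rw [← sum_measure_singleton]
    have : ∀ ω, uniformRows k n {ω} = (n : ℝ≥0∞)⁻¹ ^ k := by
      intro ω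
      rw [uniformRows, Measure.pi_singleton]
      simp
    simp only [this, Finset.sum_const, nsmul_eq_mul]
    rw [ENNReal.ofReal_div_of_pos (by positivity), ENNReal.ofReal_natCast,
      ENNReal.ofReal_pow hn'.le, ENNReal.ofReal_natCast, ← ENNReal.inv_pow, div_eq_mul_inv]
  calc ENNReal.ofReal (1 - B.card / (n : ℝ) ^ k)
      = 1 - ENNReal.ofReal (B.card / (n : ℝ) ^ k) := by
        rw [ENNReal.ofReal_sub _ (by positivity), ENNReal.ofReal_one]
    _ = uniformRows k n (B : Set (Fin k → Fin n))ᶜ := by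
        rw [prob_compl_eq_one_sub B.measurableSet, hB]
    _ ≤ uniformRows k n s := measure_mono fun ω hω => h ω (by simpa using hω)

theorem upper_tail_exponent {x : ℝ} (hx : 0 ≤ x) :
    x ^ 2 / 8 ≤ min 1 ((2 * x + x ^ 2) / 4) *
      ((1 + x) ^ 2 - Real.exp (min 1 ((2 * x + x ^ 2) / 4))) := by
  set a := min 1 ((2 * x + x ^ 2) / 4) with ha
  have ha0 : 0 ≤ a := le_min zero_le_one (by positivity)
  have hexp : Real.exp a ≤ 1 + 2 * a := by
    have := (abs_le.mp (Real.abs_exp_sub_one_le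
      (by rw [abs_of_nonneg ha0]; exact min_le_left _ _))).2
    rw [abs_of_nonneg ha0] at this
    linarith
  have h1 : a * ((1 + x) ^ 2 - (1 + 2 * a)) ≤ a * ((1 + x) ^ 2 - Real.exp a) := by gcongr
  refine le_trans ?_ h1
  rcases min_cases 1 ((2 * x + x ^ 2) / 4) with ⟨h, h'⟩ | ⟨h, h'⟩
  · rw [ha, h]
    nlinarith
  · rw [ha, h]
    nlinarith [pow_nonneg hx 3, pow_nonneg hx 4]

theorem lower_tail_exponent {x : ℝ} (hx : 0 ≤ x) (hx1 : x ≤ 1) :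
    x ^ 2 / 8 ≤ (2 * x - x ^ 2) / 4 *
      (1 - 2 * ((2 * x - x ^ 2) / 4) - (1 - x) ^ 2) := by
  have h : x ≤ 2 * x - x ^ 2 := by nlinarith
  have := pow_le_pow_left₀ hx h 2
  nlinarith

theorem sum_vecMulVec_row {n d : ℕ} (U : Matrix (Fin n) (Fin d) ℝ) :
    ∑ i, vecMulVec (U i) (U i) = Uᵀ * U := by
  ext i j
  simp [Matrix.sum_apply, vecMulVec_apply, mul_apply]

/-- From the exponential Markov bound to the tail bound. -/
theorem le_mul_exp_of_mul_exp_le {B C p r x : ℝ} (hC : 0 ≤ C)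
    (h : B * Real.exp p ≤ C * Real.exp r) (hx : r - p ≤ x) : B ≤ C * Real.exp x := by
  calc B = B * Real.exp p * Real.exp (-p) := by rw [mul_assoc, ← Real.exp_add]; simp
    _ ≤ C * Real.exp r * Real.exp (-p) := by gcongr
    _ = C * Real.exp (r - p) := by rw [mul_assoc, ← Real.exp_add, sub_eq_add_neg]
    _ ≤ C * Real.exp x := by gcongr

section Tails

variable {n d k : ℕ} {U : Matrix (Fin n) (Fin d) ℝ} {m t : ℝ}

open Classical in
theorem card_sampledGram_upper_tail_le (hU : Uᵀ * U = 1) (hn : 0 < n) (hk : 0 < k) (hm0 : 0 < m)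
    (hm : ∀ i, U i ⬝ᵥ U i ≤ m) (ht : 0 ≤ t) :
    ((Finset.univ.filter fun ω : Fin k → Fin n => ∃ μ ∈ spectrum ℝ (sampledGram U ω),
        (1 + t * √(m * n / k)) ^ 2 ≤ μ).card : ℝ) ≤
      (n : ℝ) ^ k * d * Real.exp (-(1 / 8) * t ^ 2) := by
  have hL : 0 < m * n / k := by positivity
  set L := m * n / k with hLdef
  have hδ : 0 ≤ t * √L := by positivity
  have key := upper_tail_exponent hδ
  set a := min 1 ((2 * (t * √L) + (t * √L) ^ 2) / 4) with ha
  have ha0 : 0 ≤ a := le_min zero_le_one (by positivity)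
  have h := card_upper_tail_le (u := U) (by rw [sum_vecMulVec_row, hU]) hk hm
    (θ := a / L) (a := a) (y := (1 + t * √L) ^ 2) (by positivity)
    (by rw [Fintype.card_fin, ← hLdef, div_mul_cancel₀ _ hL.ne']) (by positivity)
  simp only [Fintype.card_fin, ← mul_assoc] at h
  refine le_mul_exp_of_mul_exp_le (by positivity) h ?_
  rw [mul_pow, Real.sq_sqrt hL.le] at key
  have : a / L * Real.exp a - a / L * (1 + t * √L) ^ 2 =
      -(a * ((1 + t * √L) ^ 2 - Real.exp a)) / L := by ring
  rw [this, div_le_iff₀ hL]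
  linarith

open Classical in
theorem card_sampledGram_lower_tail_le (hU : Uᵀ * U = 1) (hn : 0 < n) (hk : 0 < k) (hm0 : 0 < m)
    (hm : ∀ i, U i ⬝ᵥ U i ≤ m) (ht : 0 ≤ t) (ht1 : t * √(m * n / k) ≤ 1) :
    ((Finset.univ.filter fun ω : Fin k → Fin n => ∃ μ ∈ spectrum ℝ (sampledGram U ω),
        μ ≤ (1 - t * √(m * n / k)) ^ 2).card : ℝ) ≤
      (n : ℝ) ^ k * d * Real.exp (-(1 / 8) * t ^ 2) := by
  have hL : 0 < m * n / k := by positivity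
  set L := m * n / k with hLdef
  have hδ : 0 ≤ t * √L := by positivity
  have key := lower_tail_exponent hδ ht1
  set a := (2 * (t * √L) - (t * √L) ^ 2) / 4 with ha
  have ha0 : 0 ≤ a := by
    rw [ha]
    nlinarith
  have h := card_lower_tail_le (u := U) (by rw [sum_vecMulVec_row, hU]) hk hm0.le hm
    (θ := a / L) (a := a) (y := (1 - t * √L) ^ 2) (by positivity)
    (by rw [Fintype.card_fin, ← hLdef, div_mul_cancel₀ _ hL.ne'])
    (by rw [ha]; nlinarith)
  simp only [Fintype.card_fin, ← mul_assoc] at h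
  refine le_mul_exp_of_mul_exp_le (by positivity) h ?_
  rw [mul_pow, Real.sq_sqrt hL.le] at key
  have : -(a / L * (1 - 2 * a)) - -(a / L * (1 - t * √L) ^ 2) =
      -(a * (1 - 2 * a - (1 - t * √L) ^ 2)) / L := by ring
  rw [this, div_le_iff₀ hL]
  linarith

end Tails

theorem leverage_bound_pos {n d : ℕ} (hd : 0 < d) {U : Matrix (Fin n) (Fin d) ℝ}
    (hU : Uᵀ * U = 1) {m : ℝ} (hm : ∀ i, U i ⬝ᵥ U i ≤ m) : 0 < m := by
  by_contra! hm0
  have hz : ∀ i, U i = 0 := by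
    intro i
    have h0 : 0 ≤ U i ⬝ᵥ U i := by simpa using dotProduct_star_self_nonneg (U i)
    exact dotProduct_self_eq_zero.mp (le_antisymm ((hm i).trans hm0) h0)
  have := congrFun (congrFun hU ⟨0, hd⟩) ⟨0, hd⟩
  simp [mul_apply, hz] at this

/-- (Vershynin.)  There is an absolute constant `c > 0` such that for every `n × d`
matrix `U` with `Uᵀ U = I_d` whose leverage scores are bounded by `m`, and every uniform
sketch `S = √(n/k) Φ` of size `k`, for all `t ≥ 0`, with probability at least
`1 − 2 d exp(−c t²)` one has
`1 − t √(m n / k) ≤ σ_min(S U) ≤ σ_max(S U) ≤ 1 + t √(m n / k)`. -/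
theorem uniform_sketch_singular_value_bound :
    ∃ c : ℝ, 0 < c ∧
      ∀ (n d k : ℕ), 0 < n → 0 < d → 0 < k →
        ∀ U : Matrix (Fin n) (Fin d) ℝ, Uᵀ * U = 1 →
          ∀ m : ℝ, (∀ i : Fin n, ∑ j, (U i j) ^ 2 ≤ m) →
            ∀ t : ℝ, 0 ≤ t →
              ENNReal.ofReal (1 - 2 * (d : ℝ) * Real.exp (-c * t ^ 2)) ≤
                uniformRows k n
                  {ω | 1 - t * Real.sqrt (m * n / k) ≤ sigmaMin (uniformSketch k n ω * U) ∧
                    sigmaMax (uniformSketch k n ω * U) ≤ 1 + t * Real.sqrt (m * n / k)} := by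
  classical
  refine ⟨1 / 8, by norm_num, ?_⟩
  intro n d k hn hd hk U hU m hm t ht
  replace hm : ∀ i, U i ⬝ᵥ U i ≤ m := fun i => by simpa [dotProduct, sq] using hm i
  have hm0 := leverage_bound_pos hd hU hm
  set δ := t * √(m * n / k) with hδ
  have hδ0 : 0 ≤ δ := by positivity
  set B₁ := Finset.univ.filter fun ω : Fin k → Fin n =>
    ∃ μ ∈ spectrum ℝ (sampledGram U ω), (1 + δ) ^ 2 ≤ μ with hB₁
  set B₂ := Finset.univ.filter fun ω : Fin k → Fin n =>
    δ ≤ 1 ∧ ∃ μ ∈ spectrum ℝ (sampledGram U ω), μ ≤ (1 - δ) ^ 2 with hB₂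
  have h₁ : (B₁.card : ℝ) ≤ (n : ℝ) ^ k * d * Real.exp (-(1 / 8) * t ^ 2) :=
    card_sampledGram_upper_tail_le hU hn hk hm0 hm ht
  have h₂ : (B₂.card : ℝ) ≤ (n : ℝ) ^ k * d * Real.exp (-(1 / 8) * t ^ 2) := by
    by_cases h1 : δ ≤ 1
    · simp only [hB₂, h1, true_and]
      exact card_sampledGram_lower_tail_le hU hn hk hm0 hm ht h1
    · simp only [hB₂, h1, false_and, Finset.filter_false, Finset.card_empty, Nat.cast_zero]
      positivity
  refine le_trans (ENNReal.ofReal_le_ofReal ?_)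
    (one_sub_card_div_le_uniformRows hn (B := B₁ ∪ B₂) fun ω hω => ?_)
  · have hcard : ((B₁ ∪ B₂).card : ℝ) ≤ B₁.card + B₂.card := by
      exact_mod_cast Finset.card_union_le B₁ B₂
    have hn' : (0 : ℝ) < (n : ℝ) ^ k := by positivity
    have : (B₁ ∪ B₂).card / (n : ℝ) ^ k ≤ 2 * d * Real.exp (-(1 / 8) * t ^ 2) := by
      rw [div_le_iff₀ hn']
      linarith
    linarith
  · simp only [Finset.mem_union, hB₁, hB₂, Finset.mem_filter, Finset.mem_univ, true_and,
      not_or, not_and, not_exists, not_le] at hω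
    constructor
    · rcases le_or_gt δ 1 with h1 | h1
      · refine le_sigmaMin_of_lt_spectrum hd ?_
        rw [uniformSketch_mul_gram]
        exact hω.2 h1
      · exact (sub_neg.mpr h1).le.trans (Real.sqrt_nonneg _)
    · refine sigmaMax_le_of_spectrum_lt hd (by positivity) ?_
      rw [uniformSketch_mul_gram]
      exact hω.1
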